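/- Let N be a positive integer, t_min < t_max, M = (N+1)/2 if N is odd or (N+2)/2 if N is even, and let Nam_N ⊂ ℝ^{2M} be the compact set of namings. Define an equivalence relation ≅ on Nam_N by declaring two namings equivalent if they are related by a finite chain of zero-additions, equal-splits, or their inverses. Then the evaluation map descends to a homeomorphism from the quotient space Nam_N/≅ (with the quotient topology) onto the convex hull of C_N([t_min,t_max]) (with the subspace topology from ℝ^N). -/

import Mathlib

/-- A naming, presented as a list of (coefficient, parameter) pairs: nonnegative
coefficients summing to one, parameters weakly increasing within `[t_min, t_max]`. -/
def IsNamingList (tmin tmax : ℝ) (L : List (ℝ × ℝ)) : Prop :=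
  (∀ p ∈ L, 0 ≤ p.1 ∧ p.2 ∈ Set.Icc tmin tmax) ∧
  (L.map Prod.fst).sum = 1 ∧ List.Chain' (fun a b : ℝ × ℝ => a.2 ≤ b.2) L

/-- `L'` is obtained from `L` by inserting a term with coefficient zero. -/
def ZeroAdd (L L' : List (ℝ × ℝ)) : Prop :=
  ∃ l1 l2 t, L = l1 ++ l2 ∧ L' = l1 ++ (0, t) :: l2

/-- `L'` is obtained from `L` by splitting one term into two terms with the same
parameter whose coefficients sum to the original coefficient. -/
def EqualSplit (L L' : List (ℝ × ℝ)) : Prop :=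
  ∃ l1 l2 c1 c2 t, L = l1 ++ (c1 + c2, t) :: l2 ∧ L' = l1 ++ (c1, t) :: (c2, t) :: l2

/-- A single move between namings: a zero-addition, an equal-split, or the inverse
of one of these, both endpoints being namings. -/
def NamingStep (tmin tmax : ℝ) (L L' : List (ℝ × ℝ)) : Prop :=
  IsNamingList tmin tmax L ∧ IsNamingList tmin tmax L' ∧
  (ZeroAdd L L' ∨ EqualSplit L L' ∨ ZeroAdd L' L ∨ EqualSplit L' L)

/-- Equivalence of namings: a finite chain of moves. -/
def NamingEquiv (tmin tmax : ℝ) : List (ℝ × ℝ) → List (ℝ × ℝ) → Prop :=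
  Relation.ReflTransGen (NamingStep tmin tmax)

/-- The set `Nam_N` of `M`-term namings, as tuples `(c, t)`, anchored at `t_min`
when `N` is even. -/
def NamSet (N M : ℕ) (tmin tmax : ℝ) (hMpos : 0 < M) :
    Set ((Fin M → ℝ) × (Fin M → ℝ)) :=
  {p | (∀ j, 0 ≤ p.1 j) ∧ (∑ j, p.1 j = 1) ∧
    (∀ j, p.2 j ∈ Set.Icc tmin tmax) ∧ Monotone p.2 ∧
    (Even N → p.2 ⟨0, hMpos⟩ = tmin)}

/-- The list of (coefficient, parameter) pairs of a tuple naming. -/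
def toNamingList {M : ℕ} (p : (Fin M → ℝ) × (Fin M → ℝ)) : List (ℝ × ℝ) :=
  List.ofFn fun j => (p.1 j, p.2 j)

/-- The `k`-th moment of a finitely supported signed measure on the line. -/
noncomputable def moment (k : ℕ) : (ℝ →₀ ℝ) →ₗ[ℝ] ℝ :=
  Finsupp.linearCombination ℝ fun x : ℝ => x ^ k

/-- The finitely supported measure with mass `c i` at `t i`. -/
noncomputable def atoms {ι : Type*} [Fintype ι] (c t : ι → ℝ) : ℝ →₀ ℝ :=
  ∑ i, Finsupp.single (t i) (c i)

/-- The finitely supported probability measures on `[a, b]`. -/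
def IsProbOn (a b : ℝ) (μ : ℝ →₀ ℝ) : Prop :=
  (∀ x, 0 ≤ μ x) ∧ (∀ x, μ x ≠ 0 → x ∈ Set.Icc a b) ∧ moment 0 μ = 1

theorem moment_eq_sum (k : ℕ) (μ : ℝ →₀ ℝ) {s : Finset ℝ} (hs : μ.support ⊆ s) :
    moment k μ = ∑ x ∈ s, μ x * x ^ k := by
  rw [moment, Finsupp.linearCombination_apply, Finsupp.sum_of_support_subset _ hs _ (by simp)]
  simp

theorem moment_single (k : ℕ) (x c : ℝ) : moment k (Finsupp.single x c) = c * x ^ k := by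
  simp [moment]

section Atoms

variable {ι : Type*} [Fintype ι]

theorem moment_atoms (k : ℕ) (c t : ι → ℝ) : moment k (atoms c t) = ∑ i, c i * t i ^ k := by
  simp [atoms, map_sum, moment_single]

theorem atoms_support_subset [DecidableEq ℝ] (c t : ι → ℝ) :
    (atoms c t).support ⊆ Finset.univ.image t := by
  intro x hx
  by_contra hx'
  rw [Finsupp.mem_support_iff] at hx
  apply hx
  rw [atoms, Finsupp.finsetSum_apply]
  refine Finset.sum_eq_zero fun i _ => Finsupp.single_eq_of_ne ?_
  rintro rfl
  exact hx' (Finset.mem_image_of_mem _ (Finset.mem_univ i))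

theorem isProbOn_atoms {a b : ℝ} {c t : ι → ℝ} (hc : ∀ i, 0 ≤ c i) (hc' : ∑ i, c i = 1)
    (ht : ∀ i, t i ∈ Set.Icc a b) : IsProbOn a b (atoms c t) := by
  classical
  refine ⟨fun x => ?_, fun x hx => ?_, by simpa [moment_atoms] using hc'⟩
  · rw [atoms, Finsupp.finsetSum_apply]
    exact Finset.sum_nonneg fun i _ => by
      rw [Finsupp.single_apply]; split_ifs <;> simp [hc i]
  · obtain ⟨i, -, rfl⟩ := Finset.mem_image.1
      (atoms_support_subset c t (Finsupp.mem_support_iff.2 hx))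
    exact ht i

end Atoms

theorem mem_convexHull_momentCurve_iff {n : ℕ} {a b : ℝ} {v : Fin n → ℝ} :
    v ∈ convexHull ℝ ((fun t : ℝ => fun i : Fin n => t ^ ((i : ℕ) + 1)) '' Set.Icc a b) ↔
      ∃ μ, IsProbOn a b μ ∧ ∀ i : Fin n, moment (i + 1) μ = v i := by
  constructor
  · rw [mem_convexHull_iff_exists_fintype]
    rintro ⟨ι, _, w, z, hw, hw', hz, rfl⟩
    choose t ht hz using hz
    refine ⟨atoms w t, isProbOn_atoms hw hw' ht, fun i => ?_⟩
    simp [moment_atoms, ← hz, Finset.sum_apply]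
  · rintro ⟨μ, ⟨h0, hI, h1⟩, hv⟩
    refine mem_convexHull_of_exists_fintype (ι := μ.support) (fun x => μ x)
      (fun x => fun i : Fin n => (x : ℝ) ^ ((i : ℕ) + 1)) (fun x => h0 x) ?_ ?_ ?_
    · rw [moment_eq_sum 0 μ subset_rfl] at h1
      rw [Finset.sum_coe_sort μ.support (fun x => μ x)]
      simpa using h1
    · exact fun x => ⟨x, hI x (Finsupp.mem_support_iff.1 x.2), rfl⟩
    · ext i
      rw [← hv i, moment_eq_sum _ μ subset_rfl, Finset.sum_apply,
        ← Finset.sum_coe_sort μ.support]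
      simp

theorem IsCompact.convexHull_of_finiteDimensional {E : Type*} [AddCommGroup E] [Module ℝ E]
    [TopologicalSpace E] [ContinuousAdd E] [ContinuousSMul ℝ E] [FiniteDimensional ℝ E]
    {s : Set E} (hs : IsCompact s) : IsCompact (convexHull ℝ s) := by
  classical
  have key : convexHull ℝ s =
      (fun p : (Fin (Module.finrank ℝ E + 1) → ℝ) × (Fin (Module.finrank ℝ E + 1) → E) =>
        ∑ i, p.1 i • p.2 i) '' (stdSimplex ℝ _ ×ˢ Set.univ.pi fun _ => s) := by
    apply Set.Subset.antisymm
    · intro x hx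
      obtain ⟨ι, _, z, w, hz, hind, hw, hw', rfl⟩ := eq_pos_convex_span_of_mem_convexHull hx
      have hcard : Fintype.card ι ≤ Fintype.card (Fin (Module.finrank ℝ E + 1)) := by
        rw [Fintype.card_fin]
        exact hind.card_le_finrank_succ.trans
          (Nat.add_le_add_right (Submodule.finrank_le _) 1)
      obtain ⟨e⟩ := Function.Embedding.nonempty_of_card_le hcard
      obtain ⟨z₀, hz₀⟩ : s.Nonempty := convexHull_nonempty_iff.1 ⟨_, hx⟩
      refine ⟨(Function.extend e w 0, Function.extend e z fun _ => z₀), ⟨⟨fun i => ?_, ?_⟩, ?_⟩, ?_⟩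
      · by_cases hi : ∃ j, e j = i
        · obtain ⟨j, rfl⟩ := hi
          simpa [e.injective.extend_apply] using (hw j).le
        · simp [Function.extend_apply' _ _ _ hi]
      · rw [← hw']
        exact (Fintype.sum_of_injective e e.injective _ _
          (fun i hi => Function.extend_apply' w (0 : Fin (Module.finrank ℝ E + 1) → ℝ) i hi)
          (fun i => (e.injective.extend_apply w _ i).symm)).symm
      · intro i _
        by_cases hi : ∃ j, e j = i
        · obtain ⟨j, rfl⟩ := hi
          simpa [e.injective.extend_apply] using hz ⟨j, rfl⟩
        · simpa [Function.extend_apply' _ _ _ hi] using hz₀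
      · exact (Fintype.sum_of_injective e e.injective _ _
          (fun i hi => by simp [Function.extend_apply' _ _ _ hi])
          (fun i => by simp [e.injective.extend_apply])).symm
    · rintro _ ⟨⟨w, z⟩, ⟨⟨hw, hw'⟩, hz⟩, rfl⟩
      exact mem_convexHull_of_exists_fintype w z hw hw' (fun i => hz i (Set.mem_univ i)) rfl
  rw [key]
  refine ((isCompact_stdSimplex ℝ _).prod (isCompact_univ_pi fun _ => hs)).image ?_
  fun_prop

/-- Among the representing measures of a point of the hull of the moment curve, one minimises the
next moment. -/
theorem exists_minimal_moment {n : ℕ} {a b : ℝ} {v : Fin n → ℝ}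
    (hv : v ∈ convexHull ℝ ((fun t : ℝ => fun i : Fin n => t ^ ((i : ℕ) + 1)) '' Set.Icc a b)) :
    ∃ μ, IsProbOn a b μ ∧ (∀ i : Fin n, moment (i + 1) μ = v i) ∧
      ∀ ν, IsProbOn a b ν → (∀ i : Fin n, moment (i + 1) ν = v i) →
        moment (n + 1) μ ≤ moment (n + 1) ν := by
  set K := convexHull ℝ
    ((fun t : ℝ => fun i : Fin (n + 1) => t ^ ((i : ℕ) + 1)) '' Set.Icc a b) with hK
  have hKc : IsCompact K := by
    refine IsCompact.convexHull_of_finiteDimensional (isCompact_Icc.image ?_)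
    fun_prop
  have hA : IsCompact (K ∩ {w | ∀ i : Fin n, w i.castSucc = v i}) := by
    refine hKc.inter_right ?_
    simp only [Set.ofPred_forall]
    exact isClosed_iInter fun i => isClosed_eq (by fun_prop) continuous_const
  have mem_of {ν : ℝ →₀ ℝ} (h1 : IsProbOn a b ν) (h2 : ∀ i : Fin n, moment (i + 1) ν = v i) :
      (fun i : Fin (n + 1) => moment (i + 1) ν) ∈ K ∩ {w | ∀ i : Fin n, w i.castSucc = v i} :=
    ⟨mem_convexHull_momentCurve_iff.2 ⟨ν, h1, fun _ => rfl⟩, fun i => by simpa using h2 i⟩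
  obtain ⟨μ₀, h1, h2⟩ := mem_convexHull_momentCurve_iff.1 hv
  obtain ⟨w, ⟨hwK, hwv⟩, hmin⟩ := hA.exists_isMinOn ⟨_, mem_of h1 h2⟩
    (f := fun w => w (Fin.last n)) (by fun_prop)
  obtain ⟨μ, hμ, hμw⟩ := mem_convexHull_momentCurve_iff.1 hwK
  refine ⟨μ, hμ, fun i => by simpa [hwv i] using hμw i.castSucc, fun ν hν hνv => ?_⟩
  have := isMinOn_iff.1 hmin _ (mem_of hν hνv)
  simpa [← hμw] using this

section DividedDifference

variable {n : ℕ} {z : ℕ → ℝ}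

theorem neg_one_pow_mul_prod_sub_pos (hz : StrictAntiOn z (Set.Iio n)) {i : ℕ} (hi : i < n) :
    0 < (-1) ^ i * ∏ j ∈ (Finset.range n).erase i, (z i - z j) := by
  have hsplit : (Finset.range n).erase i = Finset.range i ∪ Finset.Ico (i + 1) n := by
    ext j; simp only [Finset.mem_erase, Finset.mem_range, Finset.mem_union, Finset.mem_Ico]; omega
  have hdisj : Disjoint (Finset.range i) (Finset.Ico (i + 1) n) := by
    rw [Finset.disjoint_left]; intro j; simp only [Finset.mem_range, Finset.mem_Ico]; omega
  have hneg : ∏ j ∈ Finset.range i, (z i - z j) = (-1) ^ i * ∏ j ∈ Finset.range i, (z j - z i) := by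
    rw [Finset.prod_congr rfl fun j _ => (neg_one_mul (z j - z i)).trans (neg_sub _ _) |>.symm,
      Finset.prod_mul_distrib, Finset.prod_const, Finset.card_range]
  rw [hsplit, Finset.prod_union hdisj, hneg, ← mul_assoc, ← mul_assoc, ← mul_pow]
  simp only [mul_neg, mul_one, neg_neg, one_pow, one_mul]
  refine mul_pos (Finset.prod_pos fun j hj => ?_) (Finset.prod_pos fun j hj => ?_)
  · have hj := Finset.mem_range.1 hj
    exact sub_pos.2 (hz (Set.mem_Iio.2 (hj.trans hi)) hi hj)
  · have hj := Finset.mem_Ico.1 hj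
    exact sub_pos.2 (hz hi (Set.mem_Iio.2 hj.2) hj.1)

theorem sum_pow_div_prod_sub (hz : Set.InjOn z (Finset.range (n + 1) : Finset ℕ)) {k : ℕ}
    (hk : k ≤ n) :
    ∑ i ∈ Finset.range (n + 1), z i ^ k / ∏ j ∈ (Finset.range (n + 1)).erase i, (z i - z j) =
      if k = n then 1 else 0 := by
  have := Lagrange.coeff_eq_sum (P := (Polynomial.X ^ k : Polynomial ℝ)) hz (by
    rw [Polynomial.degree_X_pow, Finset.card_range]; exact_mod_cast Nat.lt_succ_of_le hk)
  simpa [Polynomial.coeff_X_pow, eq_comm] using this.symm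

/-- A minimiser of the `(n + 1)`-st moment cannot charge every second point of a decreasing sequence
of length `n + 2`: otherwise the divided difference along the sequence is an admissible direction
that decreases this moment. -/
theorem not_supported_of_minimal {a b : ℝ} {μ : ℝ →₀ ℝ} (hμ : IsProbOn a b μ)
    (hmin : ∀ ν, IsProbOn a b ν → (∀ k ≤ n, moment k ν = moment k μ) →
      moment (n + 1) μ ≤ moment (n + 1) ν)
    (hz : StrictAntiOn z (Set.Iio (n + 2))) (hI : ∀ i < n + 2, z i ∈ Set.Icc a b)
    (hsupp : ∀ i < n + 2, Even i → μ (z i) ≠ 0) : False := by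
  classical
  set D : ℕ → ℝ := fun i => ∏ j ∈ (Finset.range (n + 2)).erase i, (z i - z j) with hD
  have hsign : ∀ i < n + 2, 0 < (-1) ^ i * D i := fun i hi => neg_one_pow_mul_prod_sub_pos hz hi
  have hinj : Set.InjOn z (Finset.range (n + 1 + 1) : Finset ℕ) := by
    rw [Finset.coe_range]; exact hz.injOn
  set δ : ℝ →₀ ℝ := ∑ i ∈ Finset.range (n + 2), Finsupp.single (z i) (D i)⁻¹ with hδ
  have hδm : ∀ k ≤ n + 1, moment k δ = if k = n + 1 then 1 else 0 := by
    intro k hk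
    rw [← sum_pow_div_prod_sub hinj hk, hδ, map_sum]
    refine Finset.sum_congr rfl fun i _ => ?_
    rw [moment_single, div_eq_inv_mul]
  have hδz : ∀ i < n + 2, δ (z i) = (D i)⁻¹ := by
    intro i hi
    rw [hδ, Finsupp.finsetSum_apply, Finset.sum_eq_single i]
    · simp
    · intro j hj hji
      exact Finsupp.single_eq_of_ne fun h => hji (hinj hj (Finset.mem_coe.2 (Finset.mem_range.2 hi)) h.symm)
    · simp [hi]
  have hδ0 : ∀ x, (∀ i < n + 2, z i ≠ x) → δ x = 0 := by
    intro x hx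
    rw [hδ, Finsupp.finsetSum_apply]
    exact Finset.sum_eq_zero fun i hi =>
      Finsupp.single_eq_of_ne (hx i (Finset.mem_range.1 hi)).symm
  obtain ⟨ε, hε, hεle⟩ : ∃ ε > 0, ∀ i ∈ (Finset.range (n + 2)).filter Even,
      ε ≤ μ (z i) * D i := by
    have hne : ((Finset.range (n + 2)).filter Even).Nonempty := ⟨0, by simp⟩
    obtain ⟨i₀, hi₀, hmin'⟩ := Finset.exists_min_image _ (fun i => μ (z i) * D i) hne
    refine ⟨_, ?_, hmin'⟩
    obtain ⟨hi, he⟩ := Finset.mem_filter.1 hi₀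
    have hi := Finset.mem_range.1 hi
    have := hsign i₀ hi
    rw [he.neg_one_pow, one_mul] at this
    exact mul_pos ((hμ.1 _).lt_of_ne (hsupp i₀ hi he).symm) this
  have hmom : ∀ k ≤ n + 1, moment k (μ - ε • δ) = moment k μ - if k = n + 1 then ε else 0 := by
    intro k hk
    rw [map_sub, map_smul, hδm k hk]
    simp
  have hν : IsProbOn a b (μ - ε • δ) := by
    refine ⟨fun x => ?_, fun x hx => ?_, ?_⟩
    · by_cases hx : ∃ i < n + 2, z i = x
      · obtain ⟨i, hi, rfl⟩ := hx
        rw [Finsupp.sub_apply, Finsupp.smul_apply, hδz i hi, smul_eq_mul, sub_nonneg,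
          ← div_eq_mul_inv]
        have hs := hsign i hi
        rcases Nat.even_or_odd i with he | ho
        · rw [he.neg_one_pow, one_mul] at hs
          exact (div_le_iff₀ hs).2 (hεle i (by simp [hi, he]))
        · rw [ho.neg_one_pow] at hs
          exact (div_nonpos_of_nonneg_of_nonpos hε.le (by linarith)).trans (hμ.1 _)
      · push Not at hx
        simpa [hδ0 x hx] using hμ.1 x
    · by_cases hx' : ∃ i < n + 2, z i = x
      · obtain ⟨i, hi, rfl⟩ := hx'
        exact hI i hi
      · push Not at hx'
        exact hμ.2.1 x (by simpa [hδ0 x hx'] using hx)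
    · rw [hmom 0 (by omega), hμ.2.2]; simp
  have h1 := hmin _ hν fun k hk => by
    rw [hmom k (by omega), if_neg (by omega), sub_zero]
  rw [hmom (n + 1) le_rfl, if_pos rfl] at h1
  linarith

/-- As `not_supported_of_minimal`, with the points of odd index chosen as midpoints. -/
theorem not_supported_of_minimal_of_midpoints {a b : ℝ} {μ : ℝ →₀ ℝ} (hμ : IsProbOn a b μ)
    (hmin : ∀ ν, IsProbOn a b ν → (∀ k ≤ n, moment k ν = moment k μ) →
      moment (n + 1) μ ≤ moment (n + 1) ν)
    {y : ℕ → ℝ} (hy : ∀ j, 2 * j ≤ n → y (j + 1) < y j)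
    (hI : ∀ j, 2 * j ≤ n + 2 → y j ∈ Set.Icc a b)
    (hsupp : ∀ j, 2 * j ≤ n + 1 → μ (y j) ≠ 0) : False := by
  have hstep : ∀ j, 2 * j ≤ n → y (j + 1) < (y j + y (j + 1)) / 2 ∧ (y j + y (j + 1)) / 2 < y j :=
    fun j hj => by have := hy j hj; constructor <;> linarith
  refine not_supported_of_minimal (n := n)
    (z := fun i => if Even i then y (i / 2) else (y (i / 2) + y (i / 2 + 1)) / 2) hμ hmin ?_ ?_ ?_
  · refine strictAntiOn_of_succ_lt Set.ordConnected_Iio ?_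
    intro i _ _ hi
    simp only [Set.mem_Iio, Nat.succ_eq_succ, Nat.succ_eq_add_one] at hi ⊢
    rcases Nat.even_or_odd' i with ⟨j, rfl | rfl⟩
    · have e1 : 2 * j / 2 = j := by omega
      have e2 : (2 * j + 1) / 2 = j := by omega
      simpa [e1, e2, Nat.even_add_one] using (hstep j (by omega)).2
    · have e1 : (2 * j + 1) / 2 = j := by omega
      have e2 : (2 * j + 1 + 1) / 2 = j + 1 := by omega
      simpa [e1, e2, Nat.even_add_one] using (hstep j (by omega)).1
  · intro i hi
    split_ifs with he
    · exact hI _ (by omega)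
    · have ho := Nat.not_even_iff.1 he
      have h1 := hI (i / 2) (by omega)
      have h2 := hI (i / 2 + 1) (by omega)
      simp only [Set.mem_Icc] at h1 h2 ⊢
      constructor <;> linarith [h1.1, h1.2, h2.1, h2.2]
  · intro i hi he
    simp only [he, if_true]
    exact hsupp _ (by omega)

end DividedDifference

/-- A minimiser charges at most `(n + 1) / 2` points, where for even `n` the left endpoint of the
interval is not counted. -/
theorem card_le_of_minimal {n m : ℕ} (hnm : n + 1 < 2 * (m + 1)) {a b : ℝ} {μ : ℝ →₀ ℝ}
    (hμ : IsProbOn a b μ)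
    (hmin : ∀ ν, IsProbOn a b ν → (∀ k ≤ n, moment k ν = moment k μ) →
      moment (n + 1) μ ≤ moment (n + 1) ν)
    {S : Finset ℝ} (hS : ∀ x ∈ S, μ x ≠ 0) (hnm' : n < 2 * m ∨ a ∉ S) : S.card ≤ m := by
  by_contra! hcard
  obtain ⟨T, hTS, hT⟩ := Finset.exists_subset_card_eq (Nat.succ_le_of_lt hcard)
  set e := T.orderEmbOfFin hT with he
  have heS : ∀ i, e i ∈ S := fun i => hTS (T.orderEmbOfFin_mem hT i)
  have heI : ∀ i, e i ∈ Set.Icc a b := fun i => hμ.2.1 _ (hS _ (heS i))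
  refine not_supported_of_minimal_of_midpoints hμ hmin
    (y := fun j => if j ≤ m then e ⟨m - j, by omega⟩ else a) ?_ ?_ ?_
  · intro j hj
    rw [if_pos (show j ≤ m by omega)]
    split_ifs with hjm
    · exact e.strictMono (by rw [Fin.mk_lt_mk]; omega)
    · have haS : a ∉ S := hnm'.resolve_left (by omega)
      exact (heI _).1.lt_of_ne fun h => haS (h ▸ heS _)
  · intro j _
    split_ifs
    · exact heI _
    · exact ⟨le_rfl, (heI 0).1.trans (heI 0).2⟩
  · intro j hj
    simp only [show j ≤ m by omega, if_true]
    exact hS _ (heS _)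

/-- A measure supported on at most `M` points is the measure of an ordered `M`-term naming whose
first parameter is the least of these points. -/
theorem exists_monotone_atoms {M : ℕ} (hM : 0 < M) {a b : ℝ} {μ : ℝ →₀ ℝ} (hμ : IsProbOn a b μ)
    {T : Finset ℝ} (hT : μ.support ⊆ T) (hTI : ∀ x ∈ T, x ∈ Set.Icc a b) (hcard : T.card ≤ M) :
    ∃ c t : Fin M → ℝ, (∀ j, 0 ≤ c j) ∧ (∀ j, t j ∈ Set.Icc a b) ∧ Monotone t ∧
      (a ∈ T → t ⟨0, hM⟩ = a) ∧ ∀ k, ∑ j, c j * t j ^ k = moment k μ := by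
  have hTne : T.Nonempty := by
    rw [Finset.nonempty_iff_ne_empty]
    rintro rfl
    have := hμ.2.2
    rw [moment_eq_sum 0 μ hT] at this
    simp at this
  obtain ⟨r, rfl⟩ := Nat.exists_eq_add_of_le hcard
  set e := T.orderEmbOfFin rfl with he
  have heT : ∀ i, e i ∈ T := T.orderEmbOfFin_mem rfl
  obtain ⟨x₀, hx₀⟩ := hTne
  have hb : b ∈ Set.Icc a b := ⟨(hTI _ hx₀).1.trans (hTI _ hx₀).2, le_rfl⟩
  refine ⟨Fin.append (fun i => μ (e i)) fun _ => 0, Fin.append e fun _ => b, ?_, ?_, ?_, ?_, ?_⟩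
  · exact Fin.addCases (fun i => by simpa using hμ.1 _) (fun i => by simp)
  · exact Fin.addCases (fun i => by simpa using hTI _ (heT i)) (fun i => by simpa using hb)
  · refine Fin.addCases (fun i => ?_) (fun i => ?_) <;>
      refine Fin.addCases (fun j => ?_) (fun j => ?_) <;> intro hij
    · rw [Fin.append_left, Fin.append_left]
      exact e.monotone hij
    · simpa using (hTI _ (heT i)).2
    · simp only [Fin.le_def, Fin.val_natAdd, Fin.val_castAdd] at hij
      have := j.2
      omega
    · simp
  · intro haT
    have hpos : 0 < T.card := Finset.card_pos.2 ⟨x₀, hx₀⟩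
    have h0 : (⟨0, hM⟩ : Fin (T.card + r)) = Fin.castAdd r ⟨0, hpos⟩ := rfl
    rw [h0, Fin.append_left, he, Finset.orderEmbOfFin_zero rfl hpos]
    exact le_antisymm (Finset.min'_le _ _ haT) (hTI _ (Finset.min'_mem _ _)).1
  · intro k
    rw [moment_eq_sum k μ hT, Fin.sum_univ_add]
    simp only [Fin.append_left, Fin.append_right, zero_mul, Finset.sum_const_zero, add_zero]
    conv_rhs => rw [← T.map_orderEmbOfFin_univ rfl]
    rw [Finset.sum_map]
    rfl

/-- The finitely supported measure named by a list of terms. -/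
noncomputable def listMeasure (L : List (ℝ × ℝ)) : ℝ →₀ ℝ :=
  (L.map fun p => Finsupp.single p.2 p.1).sum

theorem listMeasure_nil : listMeasure [] = 0 := rfl

theorem listMeasure_cons (p : ℝ × ℝ) (L : List (ℝ × ℝ)) :
    listMeasure (p :: L) = Finsupp.single p.2 p.1 + listMeasure L := by
  simp [listMeasure]

theorem listMeasure_append (L L' : List (ℝ × ℝ)) :
    listMeasure (L ++ L') = listMeasure L + listMeasure L' := by
  simp [listMeasure]

theorem listMeasure_toNamingList {M : ℕ} (p : (Fin M → ℝ) × (Fin M → ℝ)) :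
    listMeasure (toNamingList p) = atoms p.1 p.2 := by
  simp [listMeasure, toNamingList, atoms, List.map_ofFn, List.sum_ofFn]

theorem ZeroAdd.listMeasure_eq {L L' : List (ℝ × ℝ)} (h : ZeroAdd L L') :
    listMeasure L = listMeasure L' := by
  obtain ⟨l1, l2, t, rfl, rfl⟩ := h
  simp [listMeasure_append, listMeasure_cons]

theorem EqualSplit.listMeasure_eq {L L' : List (ℝ × ℝ)} (h : EqualSplit L L') :
    listMeasure L = listMeasure L' := by
  obtain ⟨l1, l2, c1, c2, t, rfl, rfl⟩ := h
  simp [listMeasure_append, listMeasure_cons, Finsupp.single_add, add_assoc]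

section NamingEquiv

variable {tmin tmax : ℝ} {L L' : List (ℝ × ℝ)}

theorem NamingStep.symm (h : NamingStep tmin tmax L L') : NamingStep tmin tmax L' L := by
  obtain ⟨h1, h2, h3⟩ := h
  exact ⟨h2, h1, by tauto⟩

theorem NamingEquiv.symm (h : NamingEquiv tmin tmax L L') : NamingEquiv tmin tmax L' L := by
  induction h with
  | refl => exact Relation.ReflTransGen.refl
  | tail _ h ih => exact Relation.ReflTransGen.head h.symm ih

theorem NamingEquiv.listMeasure_eq (h : NamingEquiv tmin tmax L L') :
    listMeasure L = listMeasure L' := by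
  induction h with
  | refl => rfl
  | tail _ h ih =>
    rw [ih]
    rcases h.2.2 with h | h | h | h
    exacts [h.listMeasure_eq, h.listMeasure_eq, h.listMeasure_eq.symm, h.listMeasure_eq.symm]

theorem isNamingList_iff_pairwise : IsNamingList tmin tmax L ↔
    (∀ p ∈ L, 0 ≤ p.1 ∧ p.2 ∈ Set.Icc tmin tmax) ∧
      (L.map Prod.fst).sum = 1 ∧ L.Pairwise fun a b => a.2 ≤ b.2 := by
  have : IsTrans (ℝ × ℝ) fun a b => a.2 ≤ b.2 := ⟨fun _ _ _ => le_trans⟩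
  rw [IsNamingList]
  refine and_congr_right fun _ => and_congr_right fun _ => ?_
  exact List.isChain_iff_pairwise

/-- Every naming is equivalent to one without zero coefficients and repeated parameters. -/
theorem IsNamingList.exists_reduced (hL : IsNamingList tmin tmax L) :
    ∃ L', NamingEquiv tmin tmax L L' ∧ (L'.Pairwise fun a b => a.2 < b.2) ∧
      ∀ p ∈ L', p.1 ≠ 0 := by
  induction hn : L.length using Nat.strong_induction_on generalizing L with
  | _ n ih =>
  subst hn
  by_cases hzero : ∃ p ∈ L, p.1 = 0
  · obtain ⟨⟨c, t⟩, hp, rfl⟩ := hzero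
    obtain ⟨l1, l2, rfl⟩ := List.append_of_mem hp
    have hL1 : IsNamingList tmin tmax (l1 ++ l2) := by
      rw [isNamingList_iff_pairwise] at hL ⊢
      refine ⟨fun p hp => hL.1 p ?_, by simpa using hL.2.1, hL.2.2.sublist ?_⟩
      · simp only [List.mem_append, List.mem_cons] at hp ⊢
        tauto
      · simp
    obtain ⟨L', h1, h2⟩ := ih _ (by simp) hL1 rfl
    exact ⟨L', Relation.ReflTransGen.head
      ⟨hL, hL1, Or.inr (Or.inr (Or.inl ⟨l1, l2, t, rfl, rfl⟩))⟩ h1, h2⟩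
  push Not at hzero
  by_cases hchain : L.IsChain fun a b => a.2 < b.2
  · have : IsTrans (ℝ × ℝ) fun a b => a.2 < b.2 := ⟨fun _ _ _ => lt_trans⟩
    exact ⟨L, Relation.ReflTransGen.refl, List.isChain_iff_pairwise.1 hchain, hzero⟩
  rw [List.isChain_iff_forall_rel_of_append_cons_cons] at hchain
  push Not at hchain
  obtain ⟨⟨c1, t⟩, ⟨c2, t'⟩, l1, l2, rfl, hle⟩ := hchain
  have htt : t = t' := by
    refine le_antisymm ?_ hle
    have := (List.pairwise_append.1 (isNamingList_iff_pairwise.1 hL).2.2).2.1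
    exact (List.pairwise_cons.1 this).1 (c2, t') (by simp)
  subst htt
  have hL1 : IsNamingList tmin tmax (l1 ++ (c1 + c2, t) :: l2) := by
    rw [isNamingList_iff_pairwise] at hL ⊢
    obtain ⟨h1, h2, h3⟩ := hL
    refine ⟨fun p hp => ?_, ?_, ?_⟩
    · simp only [List.mem_append, List.mem_cons] at hp
      rcases hp with hp | rfl | hp
      · exact h1 p (by simp [hp])
      · have h4 := h1 (c1, t) (by simp)
        have h5 := h1 (c2, t) (by simp)
        exact ⟨add_nonneg h4.1 h5.1, h4.2⟩
      · exact h1 p (by simp [hp])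
    · simpa [add_assoc] using h2
    · have h4 := h3.sublist (l₁ := l1 ++ (c1, t) :: l2) (by simp)
      simpa [List.pairwise_append] using h4
  obtain ⟨L', h1, h2⟩ := ih _ (by simp) hL1 rfl
  exact ⟨L', Relation.ReflTransGen.head
    ⟨hL, hL1, Or.inr (Or.inr (Or.inr ⟨l1, l2, c1, c2, t, rfl, rfl⟩))⟩ h1, h2⟩

theorem listMeasure_apply_eq_zero {x : ℝ} (h : ∀ p ∈ L, p.2 ≠ x) : listMeasure L x = 0 := by
  induction L with
  | nil => simp [listMeasure_nil]
  | cons q L ih =>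
    rw [listMeasure_cons, Finsupp.add_apply, ih fun p hp => h p (by simp [hp]),
      Finsupp.single_eq_of_ne (h q (by simp)).symm, add_zero]

theorem listMeasure_apply_of_mem (hL : L.Pairwise fun a b => a.2 < b.2) {p : ℝ × ℝ} (hp : p ∈ L) :
    listMeasure L p.2 = p.1 := by
  induction L with
  | nil => simp at hp
  | cons q L ih =>
    rw [List.pairwise_cons] at hL
    rw [listMeasure_cons, Finsupp.add_apply]
    rcases List.mem_cons.1 hp with rfl | hp
    · rw [listMeasure_apply_eq_zero fun r hr => (hL.1 r hr).ne', Finsupp.single_eq_same, add_zero]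
    · rw [ih hL.2 hp, Finsupp.single_eq_of_ne (hL.1 p hp).ne', zero_add]

theorem mem_iff_of_reduced (hL : L.Pairwise fun a b => a.2 < b.2) (h0 : ∀ p ∈ L, p.1 ≠ 0)
    (p : ℝ × ℝ) : p ∈ L ↔ p.1 ≠ 0 ∧ listMeasure L p.2 = p.1 := by
  refine ⟨fun hp => ⟨h0 p hp, listMeasure_apply_of_mem hL hp⟩, fun ⟨hp, hμ⟩ => ?_⟩
  by_contra hmem
  have : ∃ q ∈ L, q.2 = p.2 := by
    by_contra! h
    exact hp (hμ ▸ listMeasure_apply_eq_zero h)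
  obtain ⟨q, hq, hqp⟩ := this
  have hqp' : q.1 = p.1 := by rw [← hμ, ← hqp, listMeasure_apply_of_mem hL hq]
  exact hmem (Prod.ext hqp' hqp ▸ hq)

theorem namingEquiv_iff_listMeasure_eq (hL : IsNamingList tmin tmax L)
    (hL' : IsNamingList tmin tmax L') :
    NamingEquiv tmin tmax L L' ↔ listMeasure L = listMeasure L' := by
  refine ⟨NamingEquiv.listMeasure_eq, fun h => ?_⟩
  obtain ⟨R, h1, h2, h3⟩ := hL.exists_reduced
  obtain ⟨R', h1', h2', h3'⟩ := hL'.exists_reduced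
  have hR : listMeasure R = listMeasure R' := by
    rw [← h1.listMeasure_eq, ← h1'.listMeasure_eq, h]
  have : Std.Irrefl fun a b : ℝ × ℝ => a.2 < b.2 := ⟨fun _ => lt_irrefl _⟩
  have : Std.Antisymm fun a b : ℝ × ℝ => a.2 < b.2 := ⟨fun _ _ h h' => absurd h h'.asymm⟩
  have hRR : R = R' := h2.eq_of_mem_iff h2' fun p => by
    rw [mem_iff_of_reduced h2 h3, mem_iff_of_reduced h2' h3', hR]
  subst hRR
  exact h1.trans h1'.symm

end NamingEquiv

theorem eq_zero_of_moments_eq_zero {n : ℕ} {δ : ℝ →₀ ℝ} {s : Finset ℝ} (hs : δ.support ⊆ s)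
    (hcard : s.card ≤ n + 1) (h : ∀ k ≤ n, moment k δ = 0) : δ = 0 := by
  have hpoly : ∀ p : Polynomial ℝ, p.natDegree ≤ n → ∑ x ∈ s, δ x * p.eval x = 0 := by
    intro p hp
    simp only [Polynomial.eval_eq_sum_range, Finset.mul_sum]
    rw [Finset.sum_comm]
    refine Finset.sum_eq_zero fun k hk => ?_
    have := h k ((Finset.mem_range_succ_iff.1 hk).trans hp)
    rw [moment_eq_sum k δ hs] at this
    rw [← mul_zero (p.coeff k), ← this, Finset.mul_sum]
    exact Finset.sum_congr rfl fun x _ => by ring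
  ext x
  by_contra hx
  have hxs : x ∈ s := hs (Finsupp.mem_support_iff.2 hx)
  have := hpoly (∏ y ∈ s.erase x, (Polynomial.X - Polynomial.C y)) (by
    rw [Polynomial.natDegree_prod_of_monic _ _ fun y _ => Polynomial.monic_X_sub_C y]
    simp [Finset.card_erase_of_mem hxs]
    omega)
  rw [Finset.sum_eq_single_of_mem x hxs] at this
  · simp only [Polynomial.eval_prod, Polynomial.eval_sub, Polynomial.eval_X, Polynomial.eval_C,
      mul_eq_zero, Finset.prod_eq_zero_iff, Finset.mem_erase] at this
    rcases this with h | ⟨y, ⟨hy, -⟩, hxy⟩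
    · exact hx h
    · exact hy (sub_eq_zero.1 hxy).symm
  · intro y hy hyx
    rw [Polynomial.eval_prod, Finset.prod_eq_zero (Finset.mem_erase.2 ⟨hyx, hy⟩) (by simp),
      mul_zero]

section NamSet

variable {N M : ℕ} {tmin tmax : ℝ} {hMpos : 0 < M}

theorem isCompact_namSet : IsCompact (NamSet N M tmin tmax hMpos) := by
  refine ((isCompact_univ_pi fun _ : Fin M => isCompact_Icc (a := (0 : ℝ)) (b := 1)).prod
    (isCompact_univ_pi fun _ : Fin M => isCompact_Icc (a := tmin) (b := tmax))).of_isClosed_subset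
    ?_ ?_
  · simp only [NamSet, Set.ofPred_and, Set.ofPred_forall, Monotone]
    refine IsClosed.inter ?_ (IsClosed.inter ?_ (IsClosed.inter ?_ (IsClosed.inter ?_ ?_)))
    · exact isClosed_iInter fun j => isClosed_le (by fun_prop) (by fun_prop)
    · exact isClosed_eq (by fun_prop) (by fun_prop)
    · exact isClosed_iInter fun j => isClosed_Icc.preimage (by fun_prop)
    · exact isClosed_iInter fun i => isClosed_iInter fun j => isClosed_iInter fun _ =>
        isClosed_le (by fun_prop) (by fun_prop)
    · exact isClosed_iInter fun _ => isClosed_eq (by fun_prop) (by fun_prop)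
  · rintro p ⟨h0, h1, hI, -⟩
    exact ⟨fun j _ => ⟨h0 j, h1 ▸ Finset.single_le_sum (fun i _ => h0 i) (Finset.mem_univ j)⟩,
      fun j _ => hI j⟩

theorem isNamingList_toNamingList {p : (Fin M → ℝ) × (Fin M → ℝ)}
    (hp : p ∈ NamSet N M tmin tmax hMpos) : IsNamingList tmin tmax (toNamingList p) := by
  obtain ⟨h0, h1, hI, hmono, -⟩ := hp
  rw [isNamingList_iff_pairwise]
  refine ⟨fun q hq => ?_, ?_, ?_⟩
  · obtain ⟨j, rfl⟩ := (List.mem_ofFn' _ _).1 hq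
    exact ⟨h0 j, hI j⟩
  · rw [toNamingList, List.map_ofFn, List.sum_ofFn]
    exact h1
  · rw [toNamingList, List.pairwise_ofFn]
    exact fun i j hij => hmono hij.le

theorem card_union_image_le (hM : M = if Odd N then (N + 1) / 2 else (N + 2) / 2)
    {p q : (Fin M → ℝ) × (Fin M → ℝ)} (hp : p ∈ NamSet N M tmin tmax hMpos)
    (hq : q ∈ NamSet N M tmin tmax hMpos) :
    (Finset.univ.image p.2 ∪ Finset.univ.image q.2).card ≤ N + 1 := by
  have h1 : (Finset.univ.image p.2).card ≤ M := Finset.card_image_le.trans (by simp)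
  have h2 : (Finset.univ.image q.2).card ≤ M := Finset.card_image_le.trans (by simp)
  have h3 := Finset.card_union_add_card_inter (Finset.univ.image p.2) (Finset.univ.image q.2)
  rcases Nat.even_or_odd N with hN | hN
  · have h4 : 0 < (Finset.univ.image p.2 ∩ Finset.univ.image q.2).card := by
      refine Finset.card_pos.2 ⟨tmin, Finset.mem_inter.2 ⟨?_, ?_⟩⟩
      · exact Finset.mem_image.2 ⟨_, Finset.mem_univ _, hp.2.2.2.2 hN⟩
      · exact Finset.mem_image.2 ⟨_, Finset.mem_univ _, hq.2.2.2.2 hN⟩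
    rw [if_neg (Nat.not_odd_iff_even.2 hN)] at hM
    omega
  · rw [if_pos hN] at hM
    have := Nat.odd_iff.1 hN
    omega

theorem namingEquiv_toNamingList_iff (hM : M = if Odd N then (N + 1) / 2 else (N + 2) / 2)
    (P Q : NamSet N M tmin tmax hMpos) :
    NamingEquiv tmin tmax (toNamingList P.1) (toNamingList Q.1) ↔
      (fun i : Fin N => ∑ j, P.1.1 j * P.1.2 j ^ ((i : ℕ) + 1)) =
        fun i : Fin N => ∑ j, Q.1.1 j * Q.1.2 j ^ ((i : ℕ) + 1) := by
  classical
  rw [namingEquiv_iff_listMeasure_eq (isNamingList_toNamingList P.2)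
    (isNamingList_toNamingList Q.2), listMeasure_toNamingList, listMeasure_toNamingList]
  simp only [← moment_atoms]
  refine ⟨fun h => by rw [h], fun h => sub_eq_zero.1 ?_⟩
  refine eq_zero_of_moments_eq_zero (n := N) (Finsupp.support_sub.trans
    (Finset.union_subset_union (atoms_support_subset _ _) (atoms_support_subset _ _)))
    (card_union_image_le hM P.2 Q.2) fun k hk => ?_
  rw [map_sub, sub_eq_zero]
  cases k with
  | zero => simp [moment_atoms, P.2.2.1, Q.2.2.1]
  | succ k => exact congrFun h ⟨k, hk⟩

theorem eval_mem_convexHull (P : NamSet N M tmin tmax hMpos) :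
    (fun i : Fin N => ∑ j, P.1.1 j * P.1.2 j ^ ((i : ℕ) + 1)) ∈ convexHull ℝ
      ((fun t : ℝ => fun i : Fin N => t ^ ((i : ℕ) + 1)) '' Set.Icc tmin tmax) :=
  mem_convexHull_momentCurve_iff.2
    ⟨atoms P.1.1 P.1.2, isProbOn_atoms P.2.1 P.2.2.1 P.2.2.2.1, fun _ => moment_atoms _ _ _⟩

theorem exists_eval_eq (h : tmin ≤ tmax)
    (hM : M = if Odd N then (N + 1) / 2 else (N + 2) / 2) {v : Fin N → ℝ}
    (hv : v ∈ convexHull ℝ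
      ((fun t : ℝ => fun i : Fin N => t ^ ((i : ℕ) + 1)) '' Set.Icc tmin tmax)) :
    ∃ P : NamSet N M tmin tmax hMpos,
      (fun i : Fin N => ∑ j, P.1.1 j * P.1.2 j ^ ((i : ℕ) + 1)) = v := by
  classical
  obtain ⟨μ, hμ, hμv, hmin⟩ := exists_minimal_moment hv
  have hmin' : ∀ ν, IsProbOn tmin tmax ν → (∀ k ≤ N, moment k ν = moment k μ) →
      moment (N + 1) μ ≤ moment (N + 1) ν := fun ν hν hk =>
    hmin ν hν fun i => (hk _ i.2).trans (hμv i)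
  obtain ⟨T, hT, hTI, hcard, hTa⟩ : ∃ T : Finset ℝ, μ.support ⊆ T ∧
      (∀ x ∈ T, x ∈ Set.Icc tmin tmax) ∧ T.card ≤ M ∧ (Even N → tmin ∈ T) := by
    have hsupp : ∀ x ∈ μ.support, μ x ≠ 0 := fun x => Finsupp.mem_support_iff.1
    rcases Nat.even_or_odd N with hN | hN
    · rw [if_neg (Nat.not_odd_iff_even.2 hN)] at hM
      have := Nat.even_iff.1 hN
      have hle : (μ.support.erase tmin).card ≤ M - 1 :=
        card_le_of_minimal (n := N) (by omega) hμ hmin'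
          (fun x hx => hsupp x (Finset.mem_of_mem_erase hx)) (Or.inr (by simp))
      refine ⟨insert tmin (μ.support.erase tmin), ?_, ?_, ?_, fun _ => by simp⟩
      · intro x hx
        by_cases hxt : x = tmin <;> simp_all
      · intro x hx
        rcases Finset.mem_insert.1 hx with rfl | hx
        · exact ⟨le_rfl, h⟩
        · exact hμ.2.1 x (hsupp x (Finset.mem_of_mem_erase hx))
      · rw [Finset.card_insert_of_notMem (by simp)]
        omega
    · rw [if_pos hN] at hM
      have := Nat.odd_iff.1 hN
      exact ⟨μ.support, subset_rfl, fun x hx => hμ.2.1 x (hsupp x hx),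
        card_le_of_minimal (n := N) (by omega) hμ hmin' hsupp (Or.inl (by omega)),
        fun he => absurd hN (Nat.not_odd_iff_even.2 he)⟩
  obtain ⟨c, t, hc, ht, hmono, ht0, hmom⟩ := exists_monotone_atoms hMpos hμ hT hTI hcard
  refine ⟨⟨(c, t), hc, ?_, ht, hmono, fun he => ht0 (hTa he)⟩, funext fun i => ?_⟩
  · simpa [hμ.2.2] using hmom 0
  · exact (hmom _).trans (hμv i)

end NamSet

/-- The evaluation map descends to a homeomorphism from the quotient of `Nam_N` by
the naming equivalence onto the convex hull of the moment curve. -/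
theorem eval_quotient_homeomorph (N : ℕ) (hN : 0 < N) (tmin tmax : ℝ) (h : tmin < tmax)
    (M : ℕ) (hM : M = if Odd N then (N + 1) / 2 else (N + 2) / 2) (hMpos : 0 < M) :
    ∃ G : Quot (fun P Q : NamSet N M tmin tmax hMpos =>
          NamingEquiv tmin tmax (toNamingList P.1) (toNamingList Q.1)) ≃ₜ
        {v : Fin N → ℝ // v ∈ convexHull ℝ
          ((fun t : ℝ => fun i : Fin N => t ^ ((i : ℕ) + 1)) '' Set.Icc tmin tmax)},
      ∀ P : NamSet N M tmin tmax hMpos,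
        (G (Quot.mk _ P) : Fin N → ℝ) =
          fun i : Fin N => ∑ j, P.1.1 j * P.1.2 j ^ ((i : ℕ) + 1) := by
  have : CompactSpace (NamSet N M tmin tmax hMpos) := isCompact_iff_compactSpace.1 isCompact_namSet
  let f : Quot (fun P Q : NamSet N M tmin tmax hMpos =>
      NamingEquiv tmin tmax (toNamingList P.1) (toNamingList Q.1)) →
      {v : Fin N → ℝ // v ∈ convexHull ℝ
        ((fun t : ℝ => fun i : Fin N => t ^ ((i : ℕ) + 1)) '' Set.Icc tmin tmax)} :=
    Quot.lift (fun P => ⟨_, eval_mem_convexHull P⟩)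
      fun P Q hPQ => Subtype.ext ((namingEquiv_toNamingList_iff hM P Q).1 hPQ)
  have hcont : Continuous f := by
    refine continuous_quot_lift _ ?_
    refine Continuous.subtype_mk ?_ _
    fun_prop
  have hbij : Function.Bijective f := by
    constructor
    · rintro ⟨P⟩ ⟨Q⟩ hPQ
      exact Quot.sound ((namingEquiv_toNamingList_iff hM P Q).2 (congrArg Subtype.val hPQ))
    · rintro ⟨v, hv⟩
      obtain ⟨P, hP⟩ := exists_eval_eq (hMpos := hMpos) h.le hM hv
      exact ⟨Quot.mk _ P, Subtype.ext hP⟩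
  exact ⟨Continuous.homeoOfEquivCompactToT2 (f := Equiv.ofBijective f hbij) hcont, fun _ => rfl⟩
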